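/- Let P be a set of n points in ℝ^d and let r be an integer with 1 ≤ r ≤ n. Then there exists a subset R ⊆ P of exactly r points such that ‖c(R) − c(P)‖ ≤ avgp(P)/√r ≤ diam(P)/√(2r). -/

import Mathlib

open Finset

/-- The centroid of a finite set of points in `ℝ^d`. -/
noncomputable def centroid {d : ℕ} (P : Finset (EuclideanSpace ℝ (Fin d))) :
    EuclideanSpace ℝ (Fin d) :=
  (P.card : ℝ)⁻¹ • ∑ p ∈ P, p

/-- The average 1-mean price of a finite set of points in `ℝ^d`. -/
noncomputable def avgp {d : ℕ} (P : Finset (EuclideanSpace ℝ (Fin d))) : ℝ :=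
  Real.sqrt ((P.card : ℝ)⁻¹ * ∑ p ∈ P, ‖p - centroid P‖ ^ 2)

section InnerProduct

variable {ι E : Type*} [NormedAddCommGroup E] [InnerProductSpace ℝ E]

theorem sum_norm_sub_sq (R : Finset ι) (v : ι → E) (x : E) :
    ∑ p ∈ R, ‖x - v p‖ ^ 2 =
      R.card * ‖x‖ ^ 2 - 2 * inner ℝ x (∑ p ∈ R, v p) + ∑ p ∈ R, ‖v p‖ ^ 2 := by
  simp only [norm_sub_sq_real, sum_add_distrib, sum_sub_distrib, ← mul_sum, inner_sum,
    sum_const, nsmul_eq_mul]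

theorem sum_sum_norm_sub_sq (R : Finset ι) (v : ι → E) (hv : ∑ p ∈ R, v p = 0) :
    ∑ q ∈ R, ∑ p ∈ R, ‖v q - v p‖ ^ 2 = 2 * R.card * ∑ p ∈ R, ‖v p‖ ^ 2 := by
  simp only [sum_norm_sub_sq, hv, inner_zero_right, sum_add_distrib, sum_sub_distrib, ← mul_sum,
    sum_const, nsmul_eq_mul]
  ring

/-- Some `k`-element subset of an `m`-element set has a squared sum at most the mean of the squared
sums over all `k`-element subsets. -/
theorem exists_subset_norm_sum_sq_le [DecidableEq ι] (v : ι → E) {k m : ℕ} (hk : 1 ≤ k)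
    (hkm : k ≤ m) : ∀ R : Finset ι, R.card = m → ∃ T ⊆ R, T.card = k ∧
      ‖∑ p ∈ T, v p‖ ^ 2 ≤ (k * (k - 1) / (m * (m - 1)) : ℝ) * ‖∑ p ∈ R, v p‖ ^ 2 +
        (k / m - k * (k - 1) / (m * (m - 1)) : ℝ) * ∑ p ∈ R, ‖v p‖ ^ 2 := by
  induction m, hkm using Nat.le_induction with
  | base =>
    intro R hR
    refine ⟨R, Subset.rfl, hR, ?_⟩
    have hk0 : (k : ℝ) ≠ 0 := by positivity
    rcases eq_or_lt_of_le hk with rfl | hk1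
    · obtain ⟨a, rfl⟩ := card_eq_one.mp hR
      simp
    · have hk1' : (k : ℝ) - 1 ≠ 0 := by
        have : (1 : ℝ) < k := by exact_mod_cast hk1
        linarith
      rw [div_self (mul_ne_zero hk0 hk1'), div_self hk0]
      simp
  | succ m hkm ih =>
    intro R hR
    have hm0 : (m : ℝ) ≠ 0 := by
      have : 0 < m := hk.trans hkm
      positivity
    set S := ∑ p ∈ R, v p with hS
    set Q := ∑ p ∈ R, ‖v p‖ ^ 2 with hQ
    set a : ℝ := k * (k - 1) / (m * (m - 1)) with ha
    set a' : ℝ := k * (k - 1) / ((m + 1 : ℕ) * ((m + 1 : ℕ) - 1)) with ha'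
    have hrec : (m + 1) * a' = a * (m - 1) := by
      rcases eq_or_ne (m : ℝ) 1 with h1 | h1
      · have : k = 1 := le_antisymm (hkm.trans (by exact_mod_cast h1.le)) hk
        simp [ha, ha', this]
      · have : (m : ℝ) - 1 ≠ 0 := sub_ne_zero.mpr h1
        rw [ha, ha']
        push_cast
        rw [add_sub_cancel_right]
        field_simp
    have hcard : (R.card : ℝ) = m + 1 := by rw [hR]; push_cast; ring
    have hne : R.Nonempty := card_pos.mp (by omega)
    obtain ⟨p, hp, hle⟩ : ∃ p ∈ R, a * ‖S - v p‖ ^ 2 + (k / m - a) * (Q - ‖v p‖ ^ 2) ≤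
        a' * ‖S‖ ^ 2 + (k / (m + 1 : ℕ) - a') * Q := by
      refine exists_le_of_sum_le hne (le_of_eq ?_)
      simp only [sum_add_distrib, ← mul_sum, sum_sub_distrib, sum_norm_sub_sq, ← hS, ← hQ,
        real_inner_self_eq_norm_sq, sum_const, nsmul_eq_mul, hcard]
      have hb : (m + 1) * (k / (m + 1 : ℕ) - a') = a + (k / m - a) * m := by
        have : ((m : ℝ) + 1) ≠ 0 := by positivity
        rw [mul_sub, hrec]
        push_cast
        field_simp
        ring
      linear_combination (-‖S‖ ^ 2) * hrec - Q * hb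
    obtain ⟨T, hTR, hT, hTle⟩ := ih (R.erase p) (by
      rw [card_erase_of_mem hp, hR, Nat.add_sub_cancel])
    refine ⟨T, hTR.trans (erase_subset _ _), hT, hTle.trans ?_⟩
    rwa [sum_erase_eq_sub hp, sum_erase_eq_sub hp]

end InnerProduct

theorem sum_sub_centroid {d : ℕ} (P : Finset (EuclideanSpace ℝ (Fin d))) :
    ∑ p ∈ P, (p - centroid P) = 0 := by
  rcases P.eq_empty_or_nonempty with rfl | hP
  · simp
  · have : (P.card : ℝ) ≠ 0 := by exact_mod_cast hP.card_ne_zero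
    rw [sum_sub_distrib, sum_const, ← Nat.cast_smul_eq_nsmul ℝ, _root_.centroid,
      smul_inv_smul₀ this, sub_self]

theorem centroid_sub_eq {d : ℕ} {R : Finset (EuclideanSpace ℝ (Fin d))} (hR : R.Nonempty)
    (x : EuclideanSpace ℝ (Fin d)) :
    centroid R - x = (R.card : ℝ)⁻¹ • ∑ p ∈ R, (p - x) := by
  have : (R.card : ℝ) ≠ 0 := by exact_mod_cast hR.card_ne_zero
  rw [sum_sub_distrib, sum_const, ← Nat.cast_smul_eq_nsmul ℝ, smul_sub, inv_smul_smul₀ this,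
    _root_.centroid]

theorem avgp_sq {d : ℕ} (P : Finset (EuclideanSpace ℝ (Fin d))) :
    avgp P ^ 2 = (P.card : ℝ)⁻¹ * ∑ p ∈ P, ‖p - centroid P‖ ^ 2 :=
  Real.sq_sqrt (by positivity)

theorem avgp_le_diam_div_sqrt_two {d : ℕ} (P : Finset (EuclideanSpace ℝ (Fin d))) :
    avgp P ≤ Metric.diam (P : Set (EuclideanSpace ℝ (Fin d))) / Real.sqrt 2 := by
  set D := Metric.diam (P : Set (EuclideanSpace ℝ (Fin d)))
  have hD0 : 0 ≤ D := Metric.diam_nonneg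
  refine le_of_sq_le_sq ?_ (by positivity)
  rw [avgp_sq, div_pow, Real.sq_sqrt zero_le_two]
  rcases P.eq_empty_or_nonempty with rfl | hP
  · simp only [sum_empty, mul_zero]
    positivity
  have hn : (0 : ℝ) < P.card := by exact_mod_cast hP.card_pos
  have hsum := sum_sum_norm_sub_sq P (fun p => p - centroid P) (sum_sub_centroid P)
  have hle : ∑ q ∈ P, ∑ p ∈ P, ‖(q - centroid P) - (p - centroid P)‖ ^ 2 ≤
      P.card * (P.card * D ^ 2) := by
    simp only [← nsmul_eq_mul]
    refine sum_le_card_nsmul _ _ _ fun q hq => sum_le_card_nsmul _ _ _ fun p hp => ?_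
    rw [sub_sub_sub_cancel_right, ← dist_eq_norm]
    gcongr
    exact Metric.dist_le_diam_of_mem P.finite_toSet.isBounded hq hp
  rw [hsum, mul_comm 2, mul_assoc] at hle
  have := le_of_mul_le_mul_left hle hn
  rw [inv_mul_le_iff₀ hn]
  linarith

/-- Derandomized mean sampling: for any `1 ≤ r ≤ n`, there is an `r`-element subset
`R ⊆ P` with `‖c(R) - c(P)‖ ≤ avgp(P)/√r ≤ diam(P)/√(2r)`. -/
theorem exists_good_subset {d : ℕ} (P : Finset (EuclideanSpace ℝ (Fin d)))
    (n r : ℕ) (hn : P.card = n) (hr1 : 1 ≤ r) (hrn : r ≤ n) :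
    ∃ R ⊆ P, R.card = r ∧
      ‖centroid R - centroid P‖ ≤ avgp P / Real.sqrt r ∧
      avgp P / Real.sqrt r ≤
        Metric.diam (P : Set (EuclideanSpace ℝ (Fin d))) / Real.sqrt (2 * r) := by
  classical
  subst hn
  obtain ⟨R, hRP, hR, hle⟩ :=
    exists_subset_norm_sum_sq_le (fun p => p - centroid P) hr1 hrn P rfl
  have hr : (0 : ℝ) < r := by exact_mod_cast hr1
  have hr1' : (1 : ℝ) ≤ r := by exact_mod_cast hr1
  have hn : (1 : ℝ) ≤ P.card := by exact_mod_cast hr1.trans hrn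
  have hsqrt : 0 < Real.sqrt r := Real.sqrt_pos.mpr hr
  have hne : R.Nonempty := card_pos.mp (by omega)
  refine ⟨R, hRP, hR, ?_, ?_⟩
  · have havg : 0 ≤ avgp P := Real.sqrt_nonneg _
    refine le_of_sq_le_sq ?_ (by positivity)
    rw [centroid_sub_eq hne, norm_smul, mul_pow, div_pow, Real.sq_sqrt hr.le, hR, norm_inv,
      Real.norm_natCast]
    have hsum : ‖∑ p ∈ R, (p - centroid P)‖ ^ 2 ≤ r * avgp P ^ 2 := by
      rw [avgp_sq, ← mul_assoc, ← div_eq_mul_inv]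
      refine hle.trans ?_
      rw [sum_sub_centroid, norm_zero, zero_pow two_ne_zero, mul_zero, zero_add]
      gcongr
      exact sub_le_self _ (div_nonneg (mul_nonneg hr.le (sub_nonneg.mpr hr1'))
        (mul_nonneg (zero_le_one.trans hn) (sub_nonneg.mpr hn)))
    calc (r : ℝ)⁻¹ ^ 2 * ‖∑ p ∈ R, (p - centroid P)‖ ^ 2
        ≤ (r : ℝ)⁻¹ ^ 2 * (r * avgp P ^ 2) := by gcongr
      _ = avgp P ^ 2 / r := by field_simp
  · rw [Real.sqrt_mul zero_le_two, ← div_div]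
    exact div_le_div_of_nonneg_right (avgp_le_diam_div_sqrt_two P) hsqrt.le
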